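/- Assume r₁ = 0. Then for all integers n ≥ 0, the Kailath–Segall polynomial A^{(n+1)} satisfies A^{(n+1)} = Σ_{k=0}^{n} (−1)^k ([n]_q!/[n−k]_q!)·(x_{k+1} + r_{k+1}·1)·A^{(n−k)}, where r_{k+1}·1 denotes the scalar r_{k+1} times the unit of the free algebra. -/

import Mathlib

open scoped BigOperators

/-- The Kailath–Segall polynomials `A_u` in the free unital `ℝ`-algebra on indeterminates
`x₀, x₁, x₂, …` (only `x_i` with `i ≥ 1` occur), indexed by finite sequences `u` of positive
integers, defined by the recursion `A_∅ = 1`, `A_{(i)} = x_i`, and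
`A_{(j,u)} = x_j·A_u − Σᵢ q^{i−1} r_{j+u(i)} A_{u∖u(i)} − Σᵢ q^{i−1} A_{(j+u(i), u∖u(i))}`. -/
noncomputable def kailathSegall (q : ℝ) (r : ℕ → ℝ) : List ℕ → FreeAlgebra ℝ ℕ
  | [] => 1
  | j :: u =>
      FreeAlgebra.ι ℝ j * kailathSegall q r u
        - ∑ i : Fin u.length,
            (q ^ (i : ℕ) * r (j + u.get i)) • kailathSegall q r (u.eraseIdx i)
        - ∑ i : Fin u.length,
            q ^ (i : ℕ) • kailathSegall q r ((j + u.get i) :: u.eraseIdx i)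
  termination_by l => l.length
  decreasing_by
  all_goals
    first
      | (simp only [List.length_cons]; omega)
      | (have hi := i.isLt
         simp only [List.length_cons, List.length_eraseIdx_of_lt hi]
         omega)

/-- The `q`-integer `[n]_q = 1 + q + ⋯ + q^{n−1}` (with `[0]_q = 0`). -/
noncomputable def qInt (q : ℝ) (n : ℕ) : ℝ := ∑ i ∈ Finset.range n, q ^ i

/-- The ratio of `q`-factorials `[n]_q!/[n−k]_q! = Π_{i=n−k+1}^{n} [i]_q`
(an empty product being `1`). -/
noncomputable def qFactRatio (q : ℝ) (n k : ℕ) : ℝ :=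
  ∏ i ∈ Finset.Icc (n - k + 1) n, qInt q i

theorem qFactRatio_zero (q : ℝ) (n : ℕ) : qFactRatio q n 0 = 1 := by
  simp [qFactRatio]

theorem qFactRatio_succ_succ (q : ℝ) (n k : ℕ) :
    qFactRatio q (n + 1) (k + 1) = qInt q (n + 1) * qFactRatio q n k := by
  unfold qFactRatio
  rw [Nat.add_sub_add_right, Finset.prod_Icc_succ_top (by omega), mul_comm]

theorem kailathSegall_cons_replicate_zero (q : ℝ) (r : ℕ → ℝ) (j : ℕ) :
    kailathSegall q r (j :: List.replicate 0 1) = FreeAlgebra.ι ℝ j := by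
  rw [List.replicate_zero, kailathSegall, kailathSegall]
  simp

theorem kailathSegall_cons_replicate_succ (q : ℝ) (r : ℕ → ℝ) (j n : ℕ) :
    kailathSegall q r (j :: List.replicate (n + 1) 1) =
      FreeAlgebra.ι ℝ j * kailathSegall q r (List.replicate (n + 1) 1)
        - qInt q (n + 1) • (kailathSegall q r ((j + 1) :: List.replicate n 1)
            + r (j + 1) • kailathSegall q r (List.replicate n 1)) := by
  have hget (i : Fin (List.replicate (n + 1) 1).length) :
      (List.replicate (n + 1) 1).get i = 1 := by simp
  have herase (i : Fin (List.replicate (n + 1) 1).length) :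
      (List.replicate (n + 1) 1).eraseIdx i = List.replicate n 1 := by
    have hi : (i : ℕ) < n + 1 := i.isLt.trans_eq List.length_replicate
    rw [List.eraseIdx_replicate, if_pos hi, Nat.add_sub_cancel]
  have hsum : ∑ i : Fin (List.replicate (n + 1) 1).length, q ^ (i : ℕ) = qInt q (n + 1) := by
    rw [Fin.sum_univ_eq_sum_range (fun i => q ^ i), List.length_replicate, qInt]
  rw [kailathSegall]
  simp only [hget, herase]
  rw [← Finset.sum_smul, ← Finset.sum_smul, ← Finset.sum_mul, hsum, smul_add, smul_smul]
  abel

/-- The expansion of `A_{(j,1,…,1)} + r_j A_{(1,…,1)}`, without any assumption on `r`. -/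
theorem kailathSegall_cons_replicate_add (q : ℝ) (r : ℕ → ℝ) (j n : ℕ) :
    kailathSegall q r (j :: List.replicate n 1)
        + r j • kailathSegall q r (List.replicate n 1) =
      ∑ k ∈ Finset.range (n + 1),
        ((-1 : ℝ) ^ k * qFactRatio q n k) •
          ((FreeAlgebra.ι ℝ (k + j) + algebraMap ℝ (FreeAlgebra ℝ ℕ) (r (k + j)))
            * kailathSegall q r (List.replicate (n - k) 1)) := by
  induction n generalizing j with
  | zero =>
    rw [kailathSegall_cons_replicate_zero]
    simp [qFactRatio_zero, kailathSegall, Algebra.algebraMap_eq_smul_one]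
  | succ n ih =>
    rw [kailathSegall_cons_replicate_succ, ih, Finset.sum_range_succ' _ (n + 1),
      Finset.smul_sum]
    simp only [qFactRatio_succ_succ, Nat.add_sub_add_right, qFactRatio_zero, pow_zero, one_mul,
      one_smul, zero_add, Nat.sub_zero, add_mul, ← Algebra.smul_def, smul_smul]
    rw [sub_add_eq_add_sub, sub_eq_add_neg, ← Finset.sum_neg_distrib, add_comm]
    congr 1
    refine Finset.sum_congr rfl fun k _ => ?_
    rw [← neg_smul, add_right_comm k 1 j, add_assoc k j 1]
    congr 1
    ring

/-- Assume `r₁ = 0`.  Then for all integers `n ≥ 0`, the Kailath–Segall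
polynomial `A^{(n+1)}` satisfies
`A^{(n+1)} = Σ_{k=0}^{n} (−1)^k ([n]_q!/[n−k]_q!)·(x_{k+1} + r_{k+1}·1)·A^{(n−k)}`,
where `A^{(n)} = A_{(1,…,1)}` (`n` ones). -/
theorem kailathSegall_ones_formula (q : ℝ) (r : ℕ → ℝ) (hr1 : r 1 = 0) (n : ℕ) :
    kailathSegall q r (List.replicate (n + 1) 1) =
      ∑ k ∈ Finset.range (n + 1),
        ((-1 : ℝ) ^ k * qFactRatio q n k) •
          ((FreeAlgebra.ι ℝ (k + 1) + algebraMap ℝ (FreeAlgebra ℝ ℕ) (r (k + 1)))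
            * kailathSegall q r (List.replicate (n - k) 1)) := by
  have h := kailathSegall_cons_replicate_add q r 1 n
  rwa [hr1, zero_smul, add_zero, ← List.replicate_succ] at h
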